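/- Let A and B be groupoids with distinguished objects a⋆ and b⋆, and let F : A ⥤ B be a functor with F.obj a⋆ = b⋆. If F is star-surjective, then the comparison functor J : Ker F ⥤ K(F) from the kernel of F to the strong homotopy kernel of F is fully faithful and essentially surjective (hence an equivalence of groupoids). -/

import Mathlib

open CategoryTheory

variable {A B : Type*} [Groupoid A] [Groupoid B]

structure KObj (F : A ⥤ B) (b : B) where
  base : A
  hom : b ⟶ F.obj base

instance KObj.groupoid (F : A ⥤ B) (b : B) : Groupoid (KObj F b) where
  Hom X Y := { α : X.base ⟶ Y.base // X.hom ≫ F.map α = Y.hom }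
  id X := ⟨𝟙 X.base, by simp⟩
  comp {X Y Z} α β := ⟨α.1 ≫ β.1, by
    rw [Functor.map_comp, ← Category.assoc, α.2, β.2]⟩
  id_comp α := Subtype.ext (Category.id_comp α.1)
  comp_id α := Subtype.ext (Category.comp_id α.1)
  assoc α β γ := Subtype.ext (Category.assoc α.1 β.1 γ.1)
  inv {X Y} α := ⟨Groupoid.inv α.1, by
    rw [Groupoid.inv_eq_inv, Functor.map_inv, IsIso.comp_inv_eq]
    exact α.2.symm⟩
  inv_comp α := Subtype.ext (by simp [Groupoid.inv_eq_inv])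
  comp_inv α := Subtype.ext (by simp [Groupoid.inv_eq_inv])

/-- Objects of the (strict) kernel of `F : A ⥤ B` at the base point `b`: pairs `(a, h)`
with `a` an object of `A` and `h : F.obj a = b`. -/
structure KerObj (F : A ⥤ B) (b : B) where
  base : A
  eq : F.obj base = b

/-- The kernel groupoid: morphisms `(a, h) ⟶ (a', h')` are the morphisms `α : a ⟶ a'`
with `eqToHom h.symm ≫ F.map α ≫ eqToHom h' = 𝟙 b`. -/
instance KerObj.groupoid (F : A ⥤ B) (b : B) : Groupoid (KerObj F b) where
  Hom X Y := { α : X.base ⟶ Y.base // eqToHom X.eq.symm ≫ F.map α ≫ eqToHom Y.eq = 𝟙 b }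
  id X := ⟨𝟙 X.base, by simp⟩
  comp {X Y Z} α β := ⟨α.1 ≫ β.1, by
    calc eqToHom X.eq.symm ≫ F.map (α.1 ≫ β.1) ≫ eqToHom Z.eq
        = (eqToHom X.eq.symm ≫ F.map α.1 ≫ eqToHom Y.eq) ≫
            (eqToHom Y.eq.symm ≫ F.map β.1 ≫ eqToHom Z.eq) := by simp
      _ = 𝟙 b := by rw [α.2, β.2, Category.comp_id]⟩
  id_comp α := Subtype.ext (Category.id_comp α.1)
  comp_id α := Subtype.ext (Category.comp_id α.1)
  assoc α β γ := Subtype.ext (Category.assoc α.1 β.1 γ.1)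
  inv {X Y} α := ⟨Groupoid.inv α.1, by
    have hm : F.map α.1 = eqToHom (X.eq.trans Y.eq.symm) := by
      simpa using congrArg (fun z => eqToHom X.eq ≫ z ≫ eqToHom Y.eq.symm) α.2
    have hm2 : inv (F.map α.1) = eqToHom (Y.eq.trans X.eq.symm) := by
      apply IsIso.inv_eq_of_hom_inv_id
      rw [hm]; simp
    rw [Groupoid.inv_eq_inv, Functor.map_inv, hm2]
    simp⟩
  inv_comp α := Subtype.ext (by simp [Groupoid.inv_eq_inv])
  comp_inv α := Subtype.ext (by simp [Groupoid.inv_eq_inv])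

/-- The comparison functor from the kernel to the strong homotopy kernel, sending
`(a, h)` to `(a, eqToHom h.symm)` and `α` to `α`. -/
def Jcomp (F : A ⥤ B) (b : B) : KerObj F b ⥤ KObj F b where
  obj X := ⟨X.base, eqToHom X.eq.symm⟩
  map {X Y} α := ⟨α.1, by
    have hm : F.map α.1 = eqToHom (X.eq.trans Y.eq.symm) := by
      simpa using congrArg (fun z => eqToHom X.eq ≫ z ≫ eqToHom Y.eq.symm) α.2
    rw [hm]
    simp⟩
  map_id X := rfl
  map_comp α β := rfl

/-- A functor between groupoids is star-surjective (a fibration) if every morphism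
starting at a value of `F` lifts along `F`, up to an equality of objects. -/
def StarSurjective {A B : Type*} [Groupoid A] [Groupoid B] (F : A ⥤ B) : Prop :=
  ∀ (a : A) ⦃b : B⦄ (β : F.obj a ⟶ b),
    ∃ (a' : A) (α : a ⟶ a') (h : F.obj a' = b), F.map α ≫ eqToHom h = β

instance Jcomp.full (F : A ⥤ B) (b : B) : (Jcomp F b).Full where
  map_surjective {X Y} f := by
    obtain ⟨α, hα⟩ := f
    change X.base ⟶ Y.base at α
    change eqToHom X.eq.symm ≫ F.map α = eqToHom Y.eq.symm at hα
    exact ⟨⟨α, by rw [← Category.assoc, hα, eqToHom_trans, eqToHom_refl]⟩, rfl⟩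

instance Jcomp.faithful (F : A ⥤ B) (b : B) : (Jcomp F b).Faithful where
  map_injective {X Y} f g h := by
    have hfg : ((Jcomp F b).map f).1 = ((Jcomp F b).map g).1 := by rw [h]
    exact Subtype.ext hfg

theorem StarSurjective.essSurj_Jcomp {F : A ⥤ B} (hF : StarSurjective F) (b : B) :
    (Jcomp F b).EssSurj where
  mem_essImage X := by
    obtain ⟨a, α, h, hα⟩ := hF X.base (inv X.hom)
    have hX : X.hom ≫ F.map α = eqToHom h.symm := by
      rw [← cancel_mono (eqToHom h), Category.assoc, hα, IsIso.hom_inv_id, eqToHom_trans,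
        eqToHom_refl]
    let f : X ⟶ (Jcomp F b).obj ⟨a, h⟩ := ⟨α, hX⟩
    exact ⟨⟨a, h⟩, ⟨(asIso f).symm⟩⟩

/-- If a pointed functor `F` between pointed groupoids is star-surjective (a
fibration), then the comparison functor `J` from the kernel of `F` to its strong
homotopy kernel is fully faithful and essentially surjective, hence an equivalence. -/
theorem stmt6 {A B : Type*} [Groupoid A] [Groupoid B] (astar : A) (bstar : B)
    (F : A ⥤ B) (hF : F.obj astar = bstar) (hfib : StarSurjective F) :
    (Jcomp F bstar).Full ∧ (Jcomp F bstar).Faithful ∧ (Jcomp F bstar).EssSurj := by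
  exact ⟨Jcomp.full F bstar, Jcomp.faithful F bstar, hfib.essSurj_Jcomp bstar⟩
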